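/- Let G be the amalgamated free product defined in the context. Then the rank of G is at least 4; that is, G cannot be generated by 3 elements. -/

import Mathlib

/-- The commutator `c = x y x⁻¹ y⁻¹` of the generators of the free group on two
generators. -/
def commF2 : FreeGroup (Fin 2) :=
  FreeGroup.of (0 : Fin 2) * FreeGroup.of (1 : Fin 2) *
    (FreeGroup.of (0 : Fin 2))⁻¹ * (FreeGroup.of (1 : Fin 2))⁻¹

theorem finrank_le_card_of_closure_eq_top {G V : Type*} [Group G] [AddCommGroup V] [Module ℚ V]
    (f : G →* Multiplicative V)
    (hf : Submodule.span ℚ (Set.range fun g => (f g).toAdd) = ⊤)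
    {S : Finset G} (hS : Subgroup.closure (S : Set G) = ⊤) :
    Module.finrank ℚ V ≤ S.card := by
  classical
  let T : Finset V := S.image fun g => (f g).toAdd
  have hT : Submodule.span ℚ (T : Set V) = ⊤ := by
    rw [eq_top_iff, ← hf, Submodule.span_le]
    rintro _ ⟨g, rfl⟩
    have hg : g ∈ Subgroup.closure (S : Set G) := hS ▸ Subgroup.mem_top g
    induction hg using Subgroup.closure_induction with
    | mem x hx => exact Submodule.subset_span (Finset.mem_coe.2 (Finset.mem_image_of_mem _ hx))
    | one => simp
    | mul x y _ _ hx hy => simpa using Submodule.add_mem _ hx hy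
    | inv x _ hx => simpa using hx
  calc Module.finrank ℚ V = Module.finrank ℚ (⊤ : Submodule ℚ V) := (finrank_top ℚ V).symm
    _ ≤ T.card := hT ▸ finrank_span_finset_le_card T
    _ ≤ S.card := Finset.card_image_le

theorem map_commF2_eq_one {A : Type*} [CommGroup A] (f : FreeGroup (Fin 2) →* A) :
    f commF2 = 1 := by
  simp [commF2]

/-- Let `G₁ = G₂ = F₂ × ℤ`, `H = ℤ × ℤ`, `φ₁(m,n) = (cᵐ, n)`, `φ₂(m,n) = (cⁿ, m)`, and
let `G` be the pushout of `G₁` and `G₂` along `H` via `φ₁, φ₂` (expressed via its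
universal property).  Then `G` cannot be generated by 3 elements, i.e. has rank at
least 4. -/
theorem pushout_rank_ge_four (G : Type) [Group G]
    (φ₁ φ₂ : Multiplicative (ℤ × ℤ) →* FreeGroup (Fin 2) × Multiplicative ℤ)
    (hφ₁ : ∀ m n : ℤ, φ₁ (Multiplicative.ofAdd (m, n)) = (commF2 ^ m, Multiplicative.ofAdd n))
    (hφ₂ : ∀ m n : ℤ, φ₂ (Multiplicative.ofAdd (m, n)) = (commF2 ^ n, Multiplicative.ofAdd m))
    (ι₁ ι₂ : FreeGroup (Fin 2) × Multiplicative ℤ →* G)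
    (hcomm : ι₁.comp φ₁ = ι₂.comp φ₂)
    (huniv : ∀ (K : Type) [Group K] (f₁ f₂ : FreeGroup (Fin 2) × Multiplicative ℤ →* K),
        f₁.comp φ₁ = f₂.comp φ₂ →
        ∃! f : G →* K, f.comp ι₁ = f₁ ∧ f.comp ι₂ = f₂) :
    ∀ S : Finset G, S.card ≤ 3 → Subgroup.closure (S : Set G) ≠ ⊤ := by
  intro S hS htop
  let F (i : Fin 2) : FreeGroup (Fin 2) × Multiplicative ℤ →* Multiplicative (Fin 2 × Fin 2 → ℚ) :=
    (FreeGroup.lift fun j => Multiplicative.ofAdd (Pi.single (i, j) 1)).comp (MonoidHom.fst _ _)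
  have hF : (F 0).comp φ₁ = (F 1).comp φ₂ := by
    refine MonoidHom.ext fun x => ?_
    have h₁ := hφ₁ x.toAdd.1 x.toAdd.2
    have h₂ := hφ₂ x.toAdd.1 x.toAdd.2
    simp only [Prod.mk.eta, ofAdd_toAdd] at h₁ h₂
    simp [F, h₁, h₂, map_commF2_eq_one]
  obtain ⟨f, ⟨hf₀, hf₁⟩, -⟩ := huniv _ _ _ hF
  have hspan : Submodule.span ℚ (Set.range fun g => (f g).toAdd) = ⊤ := by
    rw [eq_top_iff, ← (Pi.basisFun ℚ (Fin 2 × Fin 2)).span_eq, Submodule.span_le]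
    rintro _ ⟨⟨i, j⟩, rfl⟩
    apply Submodule.subset_span
    fin_cases i
    · exact ⟨ι₁ (FreeGroup.of j, 1), by
        simp [← MonoidHom.comp_apply f ι₁, hf₀, F]⟩
    · exact ⟨ι₂ (FreeGroup.of j, 1), by
        simp [← MonoidHom.comp_apply f ι₂, hf₁, F]⟩
  have h := finrank_le_card_of_closure_eq_top f hspan htop
  simp at h
  omega
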